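/- Let f : ℝ → ℝ be a smooth π-periodic odd function with f'(x) + 1 > 0 for all x, write ℝ^{n+1} = ℝᵏ ⊕ ℝˡ with k, ℓ ≥ 1, and let φ : Sⁿ → ℝ be given by φ(cos x · u, sin x · v) = ∫₀ˣ f(s) ds for unit vectors u ∈ ℝᵏ, v ∈ ℝˡ. Then φ is a c-convex potential for the cost c(p,q) = d(p,q)²/2: it satisfies (φ^c)^c = φ, where φ^c(p) = sup_{q ∈ Sⁿ} { −c(p,q) − φ(q) }. -/

import Mathlib

/- Godoy–Salvai, proof of Theorem 3: the potential `φ(cos x · u, sin x · v) = ∫₀ˣ f(s) ds`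
on the sphere `Sⁿ ⊆ ℝᵏ ⊕ ℝˡ` is a `c`-convex potential for the cost `c = d²/2`, i.e.
`(φ^c)^c = φ`, where `ψ^c(p) = sup_{q ∈ Sⁿ} {−c(p,q) − ψ(q)}`. -/

open Metric
open scoped InnerProductSpace

noncomputable section

/-- `ℝ^{n+1} = ℝᵏ ⊕ ℝˡ` with its Euclidean (ℓ²) structure. -/
abbrev SplitSpace (k l : ℕ) : Type :=
  WithLp 2 (EuclideanSpace ℝ (Fin k) × EuclideanSpace ℝ (Fin l))

/-- The point `(a, b)` of `ℝᵏ ⊕ ℝˡ`. -/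
abbrev splitPt {k l : ℕ} (a : EuclideanSpace ℝ (Fin k)) (b : EuclideanSpace ℝ (Fin l)) :
    SplitSpace k l :=
  (WithLp.equiv 2 (EuclideanSpace ℝ (Fin k) × EuclideanSpace ℝ (Fin l))).symm (a, b)

/-- The quadratic transport cost `c(p,q) = d(p,q)²/2` on the sphere, where
`d(p,q) = arccos ⟪p,q⟫` is the geodesic distance. -/
def sphereCost {E : Type*} [NormedAddCommGroup E] [InnerProductSpace ℝ E]
    (p q : sphere (0 : E) 1) : ℝ :=
  Real.arccos ⟪(p : E), (q : E)⟫_ℝ ^ 2 / 2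

/-- The supremal convolution (`c`-transform) `ψ^c(p) = sup_{q ∈ Sⁿ} {−c(p,q) − ψ(q)}`. -/
def supConv {E : Type*} [NormedAddCommGroup E] [InnerProductSpace ℝ E]
    (ψ : sphere (0 : E) 1 → ℝ) : sphere (0 : E) 1 → ℝ :=
  fun p => ⨆ q : sphere (0 : E) 1, (-(sphereCost p q) - ψ q)

/-- If every point lies in the argmin of `c(x, ·) + ψ` for some `x`, then `ψ` is `c`-convex. -/
lemma supConv_supConv_of_exists_argmin {E : Type*} [NormedAddCommGroup E] [InnerProductSpace ℝ E]
    (ψ : sphere (0 : E) 1 → ℝ)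
    (h : ∀ q, ∃ p, ∀ r, sphereCost p q + ψ q ≤ sphereCost p r + ψ r) :
    supConv (supConv ψ) = ψ := by
  have hnn (p q : sphere (0 : E) 1) : 0 ≤ sphereCost p q := by
    unfold sphereCost; positivity
  have hle (p q : sphere (0 : E) 1) : sphereCost p q ≤ Real.pi ^ 2 / 2 := by
    unfold sphereCost
    gcongr
    · exact Real.arccos_nonneg _
    · exact Real.arccos_le_pi _
  have hsymm (p q : sphere (0 : E) 1) : sphereCost p q = sphereCost q p := by
    unfold sphereCost; rw [real_inner_comm]
  funext q
  have : Nonempty (sphere (0 : E) 1) := ⟨q⟩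
  obtain ⟨p, hp⟩ := h q
  have hbdd (p' : sphere (0 : E) 1) :
      BddAbove (Set.range fun r => -(sphereCost p' r) - ψ r) := by
    refine ⟨Real.pi ^ 2 / 2 - ψ q, ?_⟩
    rintro _ ⟨r, rfl⟩
    have h1 := hp r
    have h2 := hle p r
    have h3 := hnn p q
    have h4 := hnn p' r
    dsimp only
    linarith
  have hupper (r : sphere (0 : E) 1) : -(sphereCost q r) - supConv ψ r ≤ ψ q := by
    have h1 : -(sphereCost r q) - ψ q ≤ supConv ψ r := le_ciSup (hbdd r) q
    rw [hsymm r q] at h1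
    linarith
  refine le_antisymm (ciSup_le hupper) ?_
  have h1 : -(sphereCost q p) - supConv ψ p ≤ supConv (supConv ψ) q :=
    le_ciSup (f := fun r => -(sphereCost q r) - supConv ψ r)
      ⟨ψ q, by rintro _ ⟨r, rfl⟩; exact hupper r⟩ p
  have h2 : supConv ψ p ≤ -(sphereCost p q) - ψ q :=
    ciSup_le fun r => by linarith [hp r]
  rw [hsymm q p] at h1
  linarith

/-- If `s ↦ f s + s` is monotone, then `y` minimises `t ↦ ∫₀ᵗ f + (f y + y - t)² / 2`. -/
lemma integral_add_sq_le_of_monotone {f : ℝ → ℝ} (hf : Continuous f)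
    (hm : Monotone fun s => f s + s) (y t : ℝ) :
    (∫ s in (0 : ℝ)..y, f s) + (f y + y - y) ^ 2 / 2 ≤
      (∫ s in (0 : ℝ)..t, f s) + (f y + y - t) ^ 2 / 2 := by
  have hi (a b : ℝ) : IntervalIntegrable f MeasureTheory.volume a b := hf.intervalIntegrable a b
  have hsub : (∫ s in (0 : ℝ)..t, f s) - ∫ s in (0 : ℝ)..y, f s = ∫ s in y..t, f s :=
    intervalIntegral.integral_interval_sub_left (hi _ _) (hi _ _)
  have hval : ∫ s in y..t, ((f s + s) - (f y + y)) =
      (∫ s in y..t, f s) + (t ^ 2 - y ^ 2) / 2 - (t - y) * (f y + y) := by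
    have hid : IntervalIntegrable (fun s : ℝ => s) MeasureTheory.volume y t :=
      continuous_id.intervalIntegrable _ _
    rw [intervalIntegral.integral_sub ((hi _ _).add hid)
        (continuous_const.intervalIntegrable _ _),
      intervalIntegral.integral_add (hi _ _) hid, integral_id,
      intervalIntegral.integral_const, smul_eq_mul]
  have hnn : 0 ≤ ∫ s in y..t, ((f s + s) - (f y + y)) := by
    rcases le_total y t with h | h
    · refine intervalIntegral.integral_nonneg h fun s hs => ?_
      have := hm hs.1
      dsimp only at this
      linarith
    · rw [intervalIntegral.integral_symm, ← intervalIntegral.integral_neg]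
      refine intervalIntegral.integral_nonneg h fun s hs => ?_
      have := hm hs.2
      dsimp only at this
      linarith
  nlinarith

lemma exists_norm_one_smul_eq {n : ℕ} (hn : 1 ≤ n) (a : EuclideanSpace ℝ (Fin n)) :
    ∃ u : EuclideanSpace ℝ (Fin n), ‖u‖ = 1 ∧ a = ‖a‖ • u := by
  by_cases ha : a = 0
  · exact ⟨EuclideanSpace.single ⟨0, hn⟩ 1, by simp, by simp [ha]⟩
  · refine ⟨‖a‖⁻¹ • a, norm_smul_inv_norm (𝕜 := ℝ) ha, ?_⟩
    rw [smul_smul, mul_inv_cancel₀ (norm_ne_zero_iff.2 ha), one_smul]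

lemma exists_polar_coordinates {k l : ℕ} (hk : 1 ≤ k) (hl : 1 ≤ l)
    (p : sphere (0 : SplitSpace k l) 1) :
    ∃ (x : ℝ) (u : EuclideanSpace ℝ (Fin k)) (v : EuclideanSpace ℝ (Fin l)),
      x ∈ Set.Icc 0 (Real.pi / 2) ∧ ‖u‖ = 1 ∧ ‖v‖ = 1 ∧
      (p : SplitSpace k l) = splitPt (Real.cos x • u) (Real.sin x • v) := by
  obtain ⟨u, hu, hpu⟩ := exists_norm_one_smul_eq hk (p : SplitSpace k l).fst
  obtain ⟨v, hv, hpv⟩ := exists_norm_one_smul_eq hl (p : SplitSpace k l).snd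
  have hp : ‖(p : SplitSpace k l).fst‖ ^ 2 + ‖(p : SplitSpace k l).snd‖ ^ 2 = 1 := by
    rw [← WithLp.prod_norm_sq_eq_of_L2, norm_eq_of_mem_sphere p, one_pow]
  have ha := norm_nonneg (p : SplitSpace k l).fst
  have hb := norm_nonneg (p : SplitSpace k l).snd
  refine ⟨Real.arccos ‖(p : SplitSpace k l).fst‖, u, v,
    ⟨Real.arccos_nonneg _, Real.arccos_le_pi_div_two.2 ha⟩, hu, hv, ?_⟩
  have hcos : Real.cos (Real.arccos ‖(p : SplitSpace k l).fst‖) = ‖(p : SplitSpace k l).fst‖ :=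
    Real.cos_arccos (by linarith) (by nlinarith)
  have hsin : Real.sin (Real.arccos ‖(p : SplitSpace k l).fst‖) = ‖(p : SplitSpace k l).snd‖ := by
    rw [Real.sin_arccos, ← eq_sub_of_add_eq' hp, Real.sqrt_sq hb]
  rw [hcos, hsin, ← hpu, ← hpv]
  rfl

lemma norm_splitPt_cos_sin {k l : ℕ} {u : EuclideanSpace ℝ (Fin k)}
    {v : EuclideanSpace ℝ (Fin l)} (hu : ‖u‖ = 1) (hv : ‖v‖ = 1) (x : ℝ) :
    ‖splitPt (Real.cos x • u) (Real.sin x • v)‖ = 1 := by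
  rw [← sq_eq_sq₀ (norm_nonneg _) zero_le_one, WithLp.prod_norm_sq_eq_of_L2]
  change ‖Real.cos x • u‖ ^ 2 + ‖Real.sin x • v‖ ^ 2 = 1 ^ 2
  simp [norm_smul, hu, hv]

lemma inner_splitPt_cos_sin {k l : ℕ} (u u' : EuclideanSpace ℝ (Fin k))
    (v v' : EuclideanSpace ℝ (Fin l)) (x y : ℝ) :
    ⟪splitPt (Real.cos x • u) (Real.sin x • v),
        splitPt (Real.cos y • u') (Real.sin y • v')⟫_ℝ =
      Real.cos x * Real.cos y * ⟪u, u'⟫_ℝ + Real.sin x * Real.sin y * ⟪v, v'⟫_ℝ := by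
  simp [WithLp.prod_inner_apply, real_inner_smul_left, real_inner_smul_right]
  ring

lemma arccos_cos_sub_sq {x y : ℝ} (h : |x - y| ≤ Real.pi) :
    Real.arccos (Real.cos (x - y)) ^ 2 = (x - y) ^ 2 := by
  rw [← Real.cos_abs, Real.arccos_cos (abs_nonneg _) h, sq_abs]

theorem potential_is_c_convex (k l : ℕ) (hk : 1 ≤ k) (hl : 1 ≤ l)
    (f : ℝ → ℝ) (hf : ContDiff ℝ (⊤ : ℕ∞) f) (hper : Function.Periodic f Real.pi)
    (hodd : ∀ x : ℝ, f (-x) = -f x) (hf' : ∀ x : ℝ, 0 < deriv f x + 1)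
    (φ : sphere (0 : SplitSpace k l) 1 → ℝ)
    (hφ : ∀ (x : ℝ) (u : EuclideanSpace ℝ (Fin k)) (v : EuclideanSpace ℝ (Fin l)),
      ‖u‖ = 1 → ‖v‖ = 1 → ∀ p : sphere (0 : SplitSpace k l) 1,
      (p : SplitSpace k l) = splitPt (Real.cos x • u) (Real.sin x • v) →
      φ p = ∫ s in (0:ℝ)..x, f s) :
    supConv (supConv φ) = φ := by
  have hd : Differentiable ℝ f := hf.differentiable (by simp)
  have hm : Monotone fun s => f s + s := by
    refine (strictMono_of_deriv_pos fun x => ?_).monotone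
    rw [((hd x).hasDerivAt.fun_add (hasDerivAt_id' x)).deriv]
    exact hf' x
  have hf0 : f 0 = 0 := by
    have := hodd 0
    rw [neg_zero] at this
    linarith
  have hfpi : f (Real.pi / 2) = 0 := by
    have h1 := hper (-(Real.pi / 2))
    rw [hodd, show -(Real.pi / 2) + Real.pi = Real.pi / 2 by ring] at h1
    linarith
  refine supConv_supConv_of_exists_argmin φ fun q => ?_
  obtain ⟨y, u, v, ⟨hy0, hy1⟩, hu, hv, hq⟩ := exists_polar_coordinates hk hl q
  set x := f y + y with hx
  have hx0 : 0 ≤ x := by simpa [hf0] using hm hy0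
  have hx1 : x ≤ Real.pi / 2 := by simpa [hfpi] using hm hy1
  have hpi := Real.pi_pos
  refine ⟨⟨splitPt (Real.cos x • u) (Real.sin x • v),
    mem_sphere_zero_iff_norm.2 (norm_splitPt_cos_sin hu hv x)⟩, fun r => ?_⟩
  obtain ⟨t, u', v', ⟨ht0, ht1⟩, hu', hv', hr⟩ := exists_polar_coordinates hk hl r
  rw [hφ y u v hu hv q hq, hφ t u' v' hu' hv' r hr]
  unfold sphereCost
  dsimp only
  rw [hq, hr, inner_splitPt_cos_sin, inner_splitPt_cos_sin, real_inner_self_eq_norm_sq,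
    real_inner_self_eq_norm_sq, hu, hv, one_pow, mul_one, mul_one, ← Real.cos_sub,
    arccos_cos_sub_sq (abs_le.2 ⟨by linarith, by linarith⟩)]
  have hinner : Real.cos x * Real.cos t * ⟪u, u'⟫_ℝ + Real.sin x * Real.sin t * ⟪v, v'⟫_ℝ ≤
      Real.cos (x - t) := by
    have hcx := Real.cos_nonneg_of_mem_Icc ⟨by linarith, hx1⟩
    have hct := Real.cos_nonneg_of_mem_Icc ⟨by linarith, ht1⟩
    have hsx := Real.sin_nonneg_of_nonneg_of_le_pi hx0 (by linarith)
    have hst := Real.sin_nonneg_of_nonneg_of_le_pi ht0 (by linarith)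
    have huu : ⟪u, u'⟫_ℝ ≤ 1 := by simpa [hu, hu'] using real_inner_le_norm u u'
    have hvv : ⟪v, v'⟫_ℝ ≤ 1 := by simpa [hv, hv'] using real_inner_le_norm v v'
    rw [Real.cos_sub]
    exact add_le_add (mul_le_of_le_one_right (mul_nonneg hcx hct) huu)
      (mul_le_of_le_one_right (mul_nonneg hsx hst) hvv)
  have hdist := pow_le_pow_left₀ (Real.arccos_nonneg _) (Real.arccos_le_arccos hinner) 2
  rw [arccos_cos_sub_sq (abs_le.2 ⟨by linarith, by linarith⟩)] at hdist
  have hmin := integral_add_sq_le_of_monotone hd.continuous hm y t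
  rw [← hx] at hmin
  linarith

end
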